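/- arXiv:1310.7919 — 2 statements merged into one kernel-verified Lean document; each statement's English description precedes it below -/
import Mathlib

section
/- Fix nonnegative reals λ∅, λ1, λ2, λ12 with λ∅ + λ1 + λ2 + λ12 = 1. Let P be the Markov transition kernel on pairs of positive integers which from state (i,j) moves to (i+1, j+1) with probability λ∅, to (1, j+1) with probability λ1, to (i+1, 1) with probability λ2, and to (1, 1) with probability λ12. Set c1 = 1−(λ2+λ12), c2 = 1−(λ1+λ12), and define π by: π(i,i) = λ∅^{i−1}λ12; π(i,j) = λ∅^{j−1}λ2·c2^{i−j−1}(1−c2) if i > j; π(i,j) = λ∅^{i−1}λ1·c1^{j−i−1}(1−c1) if i < j. Then π is stationary for P: for every pair (k,l) of positive integers, π(k,l) = Σ_{(i,j)} π(i,j)·P((i,j),(k,l)). -/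
/-- The stationary joint distribution of the ages of information `(A1, A2)` in a star
gossip network with one source and two receivers. Here `c1 = 1 - (l2 + l12)` and
`c2 = 1 - (l1 + l12)`. -/
noncomputable def starPi (l0 l1 l2 l12 : ℝ) (i j : ℕ+) : ℝ :=
  if i = j then l0 ^ ((i : ℕ) - 1) * l12
  else if j < i then
    l0 ^ ((j : ℕ) - 1) * l2 * (1 - (l1 + l12)) ^ ((i : ℕ) - (j : ℕ) - 1) * (l1 + l12)
  else
    l0 ^ ((i : ℕ) - 1) * l1 * (1 - (l2 + l12)) ^ ((j : ℕ) - (i : ℕ) - 1) * (l2 + l12)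

/-- The transition kernel of the joint ages `(A1, A2)` in the two-receiver star network:
from `(i,j)` move to `(i+1, j+1)` w.p. `λ∅`, to `(1, j+1)` w.p. `λ1`, to `(i+1, 1)` w.p. `λ2`,
and to `(1,1)` w.p. `λ12`. -/
def starKernel (l0 l1 l2 l12 : ℝ) (s t : ℕ+ × ℕ+) : ℝ :=
  (if t = (s.1 + 1, s.2 + 1) then l0 else 0) +
  (if t = (1, s.2 + 1) then l1 else 0) +
  (if t = (s.1 + 1, 1) then l2 else 0) +
  (if t = (1, 1) then l12 else 0)

theorem starPi_swap (l0 l1 l2 l12 : ℝ) (i j : ℕ+) :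
    starPi l0 l1 l2 l12 i j = starPi l0 l2 l1 l12 j i := by
  rcases lt_trichotomy i j with h | rfl | h
  · simp [starPi, h.ne, h.ne', h, h.not_gt]
  · simp [starPi]
  · simp [starPi, h.ne, h.ne', h, h.not_gt]

theorem starPi_one_one (l0 l1 l2 l12 : ℝ) : starPi l0 l1 l2 l12 1 1 = l12 := by
  simp [starPi]

theorem starPi_succ_succ (l0 l1 l2 l12 : ℝ) (i j : ℕ+) :
    starPi l0 l1 l2 l12 (i + 1) (j + 1) = starPi l0 l1 l2 l12 i j * l0 := by
  have pow_pnat (n : ℕ+) : l0 ^ (n : ℕ) = l0 ^ ((n : ℕ) - 1) * l0 := by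
    rw [← pow_succ, Nat.sub_add_cancel n.pos]
  simp only [starPi, add_left_inj, add_lt_add_iff_right, PNat.add_coe, PNat.one_coe,
    Nat.add_sub_cancel, Nat.add_sub_add_right, pow_pnat]
  split_ifs <;> ring

theorem starPi_succ_one (l0 l1 l2 l12 : ℝ) (i : ℕ+) :
    starPi l0 l1 l2 l12 (i + 1) 1 =
      (l1 + l12) * (1 - (l1 + l12)) ^ ((i : ℕ) - 1) * l2 := by
  have h : (1 : ℕ+) < i + 1 := PNat.lt_add_left 1 i
  simp only [starPi, h.ne', h, if_true, if_false, PNat.add_coe, PNat.one_coe,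
    Nat.add_sub_cancel, Nat.sub_self, pow_zero]
  ring

theorem starPi_one_succ (l0 l1 l2 l12 : ℝ) (j : ℕ+) :
    starPi l0 l1 l2 l12 1 (j + 1) =
      (l2 + l12) * (1 - (l2 + l12)) ^ ((j : ℕ) - 1) * l1 := by
  rw [starPi_swap, starPi_succ_one]

theorem starPi_nonneg {l0 l1 l2 l12 : ℝ} (h0 : 0 ≤ l0) (h1 : 0 ≤ l1) (h2 : 0 ≤ l2)
    (h12 : 0 ≤ l12) (hsum : l0 + l1 + l2 + l12 = 1) (i j : ℕ+) :
    0 ≤ starPi l0 l1 l2 l12 i j := by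
  have hc1 : 0 ≤ 1 - (l2 + l12) := by linarith
  have hc2 : 0 ≤ 1 - (l1 + l12) := by linarith
  unfold starPi
  split_ifs <;> positivity

theorem hasSum_pnat_of_succ {f : ℕ+ → ℝ} {a : ℝ} (h : HasSum (fun n : ℕ+ => f (n + 1)) a) :
    HasSum f (f 1 + a) := by
  rw [← Equiv.pnatEquivNat.symm.hasSum_iff] at h ⊢
  exact h.zero_add

theorem hasSum_pnat_geometric {p : ℝ} (hp : 0 < p) (hp1 : p ≤ 1) :
    HasSum (fun n : ℕ+ => p * (1 - p) ^ ((n : ℕ) - 1)) 1 := by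
  have h := (hasSum_geometric_of_lt_one (r := 1 - p) (by linarith) (by linarith)).mul_left p
  rw [sub_sub_cancel, mul_inv_cancel₀ hp.ne'] at h
  rw [← Equiv.pnatEquivNat.symm.hasSum_iff]
  exact h

/-- The first marginal of `starPi` is geometric with parameter `l1 + l12`. -/
theorem hasSum_starPi_row {l0 l1 l2 l12 : ℝ} (h0 : 0 ≤ l0) (h1 : 0 ≤ l1)
    (hsum : l0 + l1 + l2 + l12 = 1) (hpos : 0 < l2 + l12) (i : ℕ+) :
    HasSum (fun j => starPi l0 l1 l2 l12 i j)
      ((l1 + l12) * (1 - (l1 + l12)) ^ ((i : ℕ) - 1)) := by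
  induction i using PNat.recOn with
  | one =>
    have h : HasSum (fun j : ℕ+ => starPi l0 l1 l2 l12 1 (j + 1)) (1 * l1) := by
      simpa only [starPi_one_succ] using
        (hasSum_pnat_geometric hpos (by linarith)).mul_right l1
    convert hasSum_pnat_of_succ h using 1
    simp [starPi_one_one, add_comm]
  | succ i ih =>
    have h := ih.mul_right l0
    simp only [← starPi_succ_succ] at h
    convert hasSum_pnat_of_succ (f := fun j => starPi l0 l1 l2 l12 (i + 1) j) h using 1
    obtain ⟨n, hn⟩ := Nat.exists_eq_add_of_le' i.pos
    simp only [starPi_succ_one, PNat.add_coe, PNat.one_coe, hn, Nat.add_sub_cancel, pow_succ]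
    rw [show l0 = 1 - (l1 + l12) - l2 by linarith]
    ring

/-- The second marginal of `starPi` is geometric with parameter `l2 + l12`. -/
theorem hasSum_starPi_column {l0 l1 l2 l12 : ℝ} (h0 : 0 ≤ l0) (h2 : 0 ≤ l2)
    (hsum : l0 + l1 + l2 + l12 = 1) (hpos : 0 < l1 + l12) (j : ℕ+) :
    HasSum (fun i => starPi l0 l1 l2 l12 i j)
      ((l2 + l12) * (1 - (l2 + l12)) ^ ((j : ℕ) - 1)) := by
  simp only [starPi_swap l0 l1 l2 l12]
  exact hasSum_starPi_row h0 h2 (by linarith) hpos j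

theorem hasSum_starPi {l0 l1 l2 l12 : ℝ} (h0 : 0 ≤ l0) (h1 : 0 ≤ l1) (h2 : 0 ≤ l2)
    (h12 : 0 < l12) (hsum : l0 + l1 + l2 + l12 = 1) :
    HasSum (fun s : ℕ+ × ℕ+ => starPi l0 l1 l2 l12 s.1 s.2) 1 := by
  have hrow := hasSum_starPi_row h0 h1 hsum (by linarith)
  have hgeo := hasSum_pnat_geometric (p := l1 + l12) (by linarith) (by linarith)
  have hs : Summable (fun s : ℕ+ × ℕ+ => starPi l0 l1 l2 l12 s.1 s.2) := by
    rw [summable_prod_of_nonneg fun s => starPi_nonneg h0 h1 h2 h12.le hsum s.1 s.2]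
    refine ⟨fun i => (hrow i).summable, ?_⟩
    simpa only [(hrow _).tsum_eq] using hgeo.summable
  rw [← (hs.hasSum.prod_fiberwise hrow).unique hgeo]
  exact hs.hasSum

/-- `starPi` is stationary for the star-network kernel: for every state `(k,l)`,
`π(k,l) = ∑_{(i,j)} π(i,j) P((i,j),(k,l))`. -/
theorem starPi_stationary (l0 l1 l2 l12 : ℝ)
    (h0 : 0 ≤ l0) (h1 : 0 ≤ l1) (h2 : 0 ≤ l2) (h12 : 0 ≤ l12)
    (hsum : l0 + l1 + l2 + l12 = 1) :
    ∀ t : ℕ+ × ℕ+,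
      starPi l0 l1 l2 l12 t.1 t.2 =
        ∑' s : ℕ+ × ℕ+, starPi l0 l1 l2 l12 s.1 s.2 * starKernel l0 l1 l2 l12 s t := by
  have one_ne (n : ℕ+) : (1 : ℕ+) ≠ n + 1 := (PNat.lt_add_left 1 n).ne
  have ne_one (n : ℕ+) : n + 1 ≠ 1 := (one_ne n).symm
  rintro ⟨k, l⟩
  refine (HasSum.tsum_eq ?_).symm
  simp only [starKernel, Prod.mk.injEq]
  induction k using PNat.recOn with
  | one =>
    induction l using PNat.recOn with
    | one =>
      simp only [one_ne, and_false, false_and, and_self, if_true, if_false, zero_add]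
      rw [starPi_one_one]
      rcases h12.eq_or_lt with rfl | hpos
      · simp
      · simpa using (hasSum_starPi h0 h1 h2 hpos hsum).mul_right l12
    | succ l _ =>
      simp only [one_ne, ne_one, and_false, false_and, true_and, if_false, zero_add, add_zero,
        add_left_inj]
      rw [starPi_one_succ]
      rcases h1.eq_or_lt with rfl | hpos
      · simp
      · have hinj : Function.Injective fun i : ℕ+ => (i, l) := Prod.mk_left_injective l
        rw [← hinj.hasSum_iff]
        · simpa [Function.comp_def] using
            (hasSum_starPi_column h0 h2 hsum (by linarith) l).mul_right l1
        · rintro ⟨i, j⟩ hij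
          have : l ≠ j := by
            rintro rfl
            exact hij ⟨i, rfl⟩
          simp [this]
  | succ k _ =>
    induction l using PNat.recOn with
    | one =>
      simp only [one_ne, ne_one, and_false, and_true, if_false, zero_add, add_zero,
        add_left_inj]
      rw [starPi_succ_one]
      rcases h2.eq_or_lt with rfl | hpos
      · simp
      · have hinj : Function.Injective fun j : ℕ+ => (k, j) := Prod.mk_right_injective k
        rw [← hinj.hasSum_iff]
        · simpa [Function.comp_def] using
            (hasSum_starPi_row h0 h1 hsum (by linarith) k).mul_right l2
        · rintro ⟨i, j⟩ hij
          have : k ≠ i := by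
            rintro rfl
            exact hij ⟨j, rfl⟩
          simp [this]
    | succ l _ =>
      simp only [ne_one, and_false, false_and, if_false, add_zero, add_left_inj]
      rw [starPi_succ_succ]
      convert hasSum_single (k, l) ?_ using 1
      · simp
      · rintro ⟨i, j⟩ hij
        have : ¬(k = i ∧ l = j) := by
          rintro ⟨rfl, rfl⟩
          exact hij rfl
        simp [this]
end

section
/- Fix t ∈ [0,1). For each integer M large enough that (1−t)M > 1 and tM is an integer, let c_M(t) = ((1−t)M − 1)(2M − 1) and let β*_M(t) = 1/(1 + √(c_M(t))) be the unique minimizer on (0,1) of the function β ↦ 1/β + c_M(t)/(1−β). Then lim_{M→∞} 2M·β*_M(t) = √(2/(1−t)). In other words, the asymptotically optimal source transmission probability for minimizing the mean age at the node at angle θ with |θ| = t from the node opposite the source is β̂* = √(2/(1−|θ|))/(2M). -/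
open Filter

/-- The mean-age cost coefficient for the node at relative distance `t` from the node
opposite the source in a ring of `2M` nodes: `c_M(t) = ((1-t)M - 1)(2M - 1)`. -/
noncomputable def ringCost (t : ℝ) (M : ℕ) : ℝ := ((1 - t) * (M : ℝ) - 1) * (2 * (M : ℝ) - 1)

/-- The optimal source transmission probability for the node at relative distance `t`:
`β*_M(t) = 1/(1 + √(c_M(t)))`. -/
noncomputable def betaStarAngle (t : ℝ) (M : ℕ) : ℝ := 1 / (1 + Real.sqrt (ringCost t M))

/-- Completing the square in the cost `1/β + s²/(1-β)`. -/
lemma one_div_add_sq_div_one_sub {s β : ℝ} (h0 : β ≠ 0) (h1 : 1 - β ≠ 0) :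
    1 / β + s ^ 2 / (1 - β) = (1 + s) ^ 2 + (1 - (1 + s) * β) ^ 2 / (β * (1 - β)) := by
  field_simp
  ring

lemma one_div_one_add_mem_Ioo {s : ℝ} (hs : 0 < s) : 1 / (1 + s) ∈ Set.Ioo (0 : ℝ) 1 :=
  ⟨by positivity, by rw [div_lt_one (by positivity)]; linarith⟩

/-- The point `1/(1+s)` is the strict minimizer of `β ↦ 1/β + s²/(1-β)` on `(0,1)`. -/
lemma one_div_add_sq_div_one_sub_lt {s β : ℝ} (hs : 0 < s) (hβ : β ∈ Set.Ioo (0 : ℝ) 1)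
    (hne : β ≠ 1 / (1 + s)) :
    1 / (1 / (1 + s)) + s ^ 2 / (1 - 1 / (1 + s)) < 1 / β + s ^ 2 / (1 - β) := by
  have hs1 : 1 + s ≠ 0 := by positivity
  have hmin := one_div_one_add_mem_Ioo hs
  have hβ1 : 0 < 1 - β := sub_pos.2 hβ.2
  have hβ0 : 0 < β := hβ.1
  rw [one_div_add_sq_div_one_sub hmin.1.ne' (sub_pos.2 hmin.2).ne',
    one_div_add_sq_div_one_sub hβ0.ne' hβ1.ne', mul_one_div_cancel hs1]
  have hsq : 1 - (1 + s) * β ≠ 0 := fun h => hne <| by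
    rw [eq_div_iff hs1]
    linarith
  have : 0 < (1 - (1 + s) * β) ^ 2 / (β * (1 - β)) := by positivity
  simpa using this

lemma ringCost_pos {t : ℝ} {M : ℕ} (hM : 1 < (1 - t) * (M : ℝ)) : 0 < ringCost t M := by
  have hM1 : (1 : ℝ) ≤ M := by
    rw [Nat.one_le_cast, Nat.one_le_iff_ne_zero]
    rintro rfl
    norm_num at hM
  exact mul_pos (by linarith) (by linarith)

lemma tendsto_two_mul_betaStarAngle {t : ℝ} (ht : t < 1) :
    Tendsto (fun M : ℕ => 2 * (M : ℝ) * betaStarAngle t M) atTop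
      (nhds (Real.sqrt (2 / (1 - t)))) := by
  have hinv : Tendsto (fun M : ℕ => (M : ℝ)⁻¹) atTop (nhds 0) :=
    tendsto_inv_atTop_nhds_zero_nat
  have hpos : 0 < 1 - t := sub_pos.2 ht
  have hlim : Tendsto
      (fun M : ℕ => 2 / ((M : ℝ)⁻¹ + Real.sqrt ((1 - t - (M : ℝ)⁻¹) * (2 - (M : ℝ)⁻¹))))
      atTop (nhds (2 / (0 + Real.sqrt ((1 - t - 0) * (2 - 0))))) := by
    refine tendsto_const_nhds.div (hinv.add
      ((tendsto_const_nhds.sub hinv).mul (tendsto_const_nhds.sub hinv)).sqrt) ?_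
    simp only [sub_zero, zero_add]
    positivity
  have hval : 2 / (0 + Real.sqrt ((1 - t - 0) * (2 - 0))) = Real.sqrt (2 / (1 - t)) := by
    symm
    rw [Real.sqrt_eq_iff_mul_self_eq (by positivity) (by positivity), div_mul_div_comm,
      zero_add, sub_zero, sub_zero, Real.mul_self_sqrt (by positivity)]
    field_simp
  rw [hval] at hlim
  refine hlim.congr' ?_
  filter_upwards [eventually_gt_atTop 0] with M hM
  have hM0 : (0 : ℝ) < M := Nat.cast_pos.2 hM
  have hc : ringCost t M = (M : ℝ) ^ 2 * ((1 - t - (M : ℝ)⁻¹) * (2 - (M : ℝ)⁻¹)) := by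
    unfold ringCost
    field_simp
  rw [betaStarAngle, hc, Real.sqrt_mul (sq_nonneg _), Real.sqrt_sq hM0.le]
  have hden : 1 + (M : ℝ) * Real.sqrt ((1 - t - (M : ℝ)⁻¹) * (2 - (M : ℝ)⁻¹)) =
      M * ((M : ℝ)⁻¹ + Real.sqrt ((1 - t - (M : ℝ)⁻¹) * (2 - (M : ℝ)⁻¹))) := by
    rw [mul_add, mul_inv_cancel₀ hM0.ne']
  rw [hden, mul_one_div, mul_comm 2 (M : ℝ), mul_div_mul_left _ _ hM0.ne']

/-- Fix `t ∈ [0,1)`. For each `M` with `(1-t)M > 1`, `β*_M(t) = 1/(1+√(c_M(t)))` is the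
unique minimizer on `(0,1)` of `β ↦ 1/β + c_M(t)/(1-β)`, and `2M β*_M(t) → √(2/(1-t))` as
`M → ∞`: the asymptotically optimal source transmission probability is
`√(2/(1-|θ|))/(2M)`. -/
theorem limit_optimal_beta_ring_angle (t : ℝ) (ht0 : 0 ≤ t) (ht1 : t < 1) :
    (∀ M : ℕ, 1 < (1 - t) * (M : ℝ) →
      betaStarAngle t M ∈ Set.Ioo (0 : ℝ) 1 ∧
      ∀ β ∈ Set.Ioo (0 : ℝ) 1, β ≠ betaStarAngle t M →
        1 / betaStarAngle t M + ringCost t M / (1 - betaStarAngle t M) <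
          1 / β + ringCost t M / (1 - β)) ∧
    Tendsto (fun M : ℕ => 2 * (M : ℝ) * betaStarAngle t M) atTop
      (nhds (Real.sqrt (2 / (1 - t)))) := by
  refine ⟨fun M hM => ?_, tendsto_two_mul_betaStarAngle ht1⟩
  have hc := ringCost_pos hM
  have hs := Real.sqrt_pos.2 hc
  refine ⟨one_div_one_add_mem_Ioo hs, fun β hβ hne => ?_⟩
  have h := one_div_add_sq_div_one_sub_lt hs hβ hne
  rwa [Real.sq_sqrt hc.le] at h
end
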